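/- Let d ≥ 1 and suppose D : ℝ^d → ℝ and ln ρ_eq : ℝ^d → ℝ have bounded derivatives up to order 4, ρ_eq > 0, and inf_x D(x) > 0. Let g : ℝ^d → ℝ be a polynomial. Then there exists a function K* : ℝ^d → ℝ of polynomial growth such that for all x ∈ ℝ^d and all ε ∈ (0,1], | ∫_{ℝ^d} g(z) q(x,z) ( β(x,z,ε) − 1 ) dz | ≤ K*(x) ε. -/

import Mathlib

open Real MeasureTheory
open scoped RealInnerProductSpace

/-- Rescaled trial density `q(x,z) = (4πD(x))^{-d/2} exp(−|z|²/(4D(x)))`. -/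
noncomputable def qscaled {d : ℕ} (D : EuclideanSpace ℝ (Fin d) → ℝ)
    (x z : EuclideanSpace ℝ (Fin d)) : ℝ :=
  (4 * π * D x) ^ (-(d : ℝ) / 2) * Real.exp (-‖z‖ ^ 2 / (4 * D x))

/-- First-order approximation
`β(x,z,ε) = min(1, exp(ε ∇_x q(x,z)·z/q(x,z) + ε ∇ρ_eq(x)·z/ρ_eq(x)))`. -/
noncomputable def betaScaled {d : ℕ} (D ρeq : EuclideanSpace ℝ (Fin d) → ℝ)
    (x z : EuclideanSpace ℝ (Fin d)) (ε : ℝ) : ℝ :=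
  min 1 (Real.exp (ε * (⟪gradient (fun w => qscaled D w z) x, z⟫ / qscaled D x z)
    + ε * (⟪gradient ρeq x, z⟫ / ρeq x)))

/-- A polynomial on Euclidean space is bounded by a multiple of a power of `1 + ‖z‖`. -/
lemma abs_mvPolynomial_eval_le {d : ℕ} (g : MvPolynomial (Fin d) ℝ) :
    ∃ (G : ℝ) (n : ℕ), 0 ≤ G ∧ ∀ z : EuclideanSpace ℝ (Fin d),
      |MvPolynomial.eval (fun i => z i) g| ≤ G * (1 + ‖z‖) ^ n := by
  induction g using MvPolynomial.induction_on with
  | C a => exact ⟨|a|, 0, abs_nonneg a, fun z => by simp⟩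
  | add p q hp hq =>
    obtain ⟨G, n, hG, hp⟩ := hp
    obtain ⟨H, m, hH, hq⟩ := hq
    refine ⟨G + H, n + m, by positivity, fun z => ?_⟩
    have h1 : (1 : ℝ) ≤ 1 + ‖z‖ := by linarith [norm_nonneg z]
    rw [map_add, add_mul]
    refine (abs_add_le _ _).trans (add_le_add ((hp z).trans ?_) ((hq z).trans ?_))
    · gcongr
      omega
    · gcongr
      omega
  | mul_X p i hp =>
    obtain ⟨G, n, hG, hp⟩ := hp
    refine ⟨G, n + 1, hG, fun z => ?_⟩
    have hi : |z i| ≤ 1 + ‖z‖ := by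
      have := PiLp.norm_apply_le z i
      rw [Real.norm_eq_abs] at this
      linarith
    rw [map_mul, MvPolynomial.eval_X, abs_mul, pow_succ, ← mul_assoc]
    exact mul_le_mul (hp z) hi (abs_nonneg _) (by positivity)

/-- A bound on the first iterated derivative bounds the Fréchet derivative. -/
lemma norm_fderiv_le_of_norm_iteratedFDeriv_one_le {E : Type*} [NormedAddCommGroup E]
    [NormedSpace ℝ E] {f : E → ℝ} {C : ℝ} (h : ∀ x, ‖iteratedFDeriv ℝ 1 f x‖ ≤ C) (x : E) :
    ‖fderiv ℝ f x‖ ≤ C := by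
  have := h x
  rwa [← norm_iteratedFDeriv_fderiv, norm_iteratedFDeriv_zero] at this

/-- Gaussian weights decay polynomially, with a constant polynomial in the variance. -/
lemma one_add_pow_mul_exp_neg_sq_div_le (k : ℕ) {r s : ℝ} (hr : 0 ≤ r) (hs : 0 < s) :
    (1 + r) ^ (2 * k) * Real.exp (-r ^ 2 / s)
      ≤ 2 ^ k * (1 + s) ^ k * (k.factorial * Real.exp 1) := by
  have h1 : (1 + r) ^ 2 ≤ 2 * (1 + s) * (1 + r ^ 2 / s) := by
    have e : 2 * (1 + s) * (1 + r ^ 2 / s) = 2 * (1 + s + r ^ 2 / s + r ^ 2) := by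
      field_simp
      ring
    have : 0 ≤ r ^ 2 / s := by positivity
    rw [e]
    nlinarith [sq_nonneg (1 - r)]
  have h2 : (1 + r ^ 2 / s) ^ k ≤ k.factorial * (Real.exp 1 * Real.exp (r ^ 2 / s)) := by
    have := Real.pow_div_factorial_le_exp (1 + r ^ 2 / s) (by positivity) k
    rw [div_le_iff₀ (by positivity), Real.exp_add] at this
    linarith
  have h3 : Real.exp (-r ^ 2 / s) = (Real.exp (r ^ 2 / s))⁻¹ := by
    rw [neg_div, Real.exp_neg]
  rw [h3, ← div_eq_mul_inv, div_le_iff₀ (Real.exp_pos _), pow_mul]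
  calc ((1 + r) ^ 2) ^ k ≤ (2 * (1 + s) * (1 + r ^ 2 / s)) ^ k := by gcongr
    _ = 2 ^ k * (1 + s) ^ k * (1 + r ^ 2 / s) ^ k := by rw [mul_pow, mul_pow]
    _ ≤ 2 ^ k * (1 + s) ^ k * (k.factorial * (Real.exp 1 * Real.exp (r ^ 2 / s))) := by gcongr
    _ = _ := by ring

/-- The logarithmic derivative of the trial density in its first argument. -/
lemma inner_gradient_qscaled_div {d : ℕ} {D : EuclideanSpace ℝ (Fin d) → ℝ}
    (hD : ∀ x, 0 < D x) (x z : EuclideanSpace ℝ (Fin d)) (hDx : DifferentiableAt ℝ D x) :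
    ⟪gradient (fun w => qscaled D w z) x, z⟫ / qscaled D x z
      = (-(d : ℝ) / 2 / D x + ‖z‖ ^ 2 / (4 * D x ^ 2)) * fderiv ℝ D x z := by
  have hs : D x ≠ 0 := (hD x).ne'
  have hb : 0 < 4 * π * D x := by have := hD x; positivity
  have h1 : HasDerivAt (fun s : ℝ => (4 * π * s) ^ (-(d : ℝ) / 2))
      (4 * π * (-(d : ℝ) / 2) * (4 * π * D x) ^ (-(d : ℝ) / 2 - 1)) (D x) := by
    simpa using ((hasDerivAt_id (D x)).const_mul (4 * π)).rpow_const
      (p := -(d : ℝ) / 2) (Or.inl hb.ne')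
  have h2 : HasDerivAt (fun s : ℝ => Real.exp (-‖z‖ ^ 2 / (4 * s)))
      (Real.exp (-‖z‖ ^ 2 / (4 * D x)) * (‖z‖ ^ 2 / (4 * D x ^ 2))) (D x) := by
    have h3 : HasDerivAt (fun s : ℝ => -‖z‖ ^ 2 / (4 * s)) _ (D x) :=
      (hasDerivAt_const (D x) (-‖z‖ ^ 2)).div ((hasDerivAt_id' (D x)).const_mul 4)
        (by simpa using hs)
    convert h3.exp using 2
    field_simp
    ring
  have h := (h1.mul h2).comp_hasFDerivAt x hDx.hasFDerivAt
  have hg : ⟪gradient (fun w => qscaled D w z) x, z⟫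
      = fderiv ℝ (fun w => qscaled D w z) x z := by
    simp [gradient]
  have hf : fderiv ℝ (fun w => qscaled D w z) x = _ := h.fderiv
  rw [hg, hf, Real.rpow_sub_one hb.ne']
  have he := (Real.exp_pos (-‖z‖ ^ 2 / (4 * D x))).ne'
  have hp := (Real.rpow_pos_of_pos hb (-(d : ℝ) / 2)).ne'
  simp only [qscaled, smul_apply, smul_eq_mul]
  generalize (4 * π * D x) ^ (-(d : ℝ) / 2) = P at *
  generalize Real.exp (-‖z‖ ^ 2 / (4 * D x)) = Q at *
  have := Real.pi_pos.ne'
  field_simp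

/-- The logarithmic derivative of a positive density. -/
lemma inner_gradient_div_eq_fderiv_log {d : ℕ} {ρ : EuclideanSpace ℝ (Fin d) → ℝ}
    (hρ : ∀ x, 0 < ρ x) (x z : EuclideanSpace ℝ (Fin d))
    (hL : DifferentiableAt ℝ (fun y => Real.log (ρ y)) x) :
    ⟪gradient ρ x, z⟫ / ρ x = fderiv ℝ (fun y => Real.log (ρ y)) x z := by
  have he : (fun y => Real.exp (Real.log (ρ y))) = ρ := funext fun y => Real.exp_log (hρ y)
  have h := hL.hasFDerivAt.exp
  rw [he, Real.exp_log (hρ x)] at h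
  have hg : ⟪gradient ρ x, z⟫ = fderiv ℝ ρ x z := by simp [gradient]
  rw [hg, h.fderiv, smul_apply, smul_eq_mul,
    mul_div_cancel_left₀ _ (hρ x).ne']

/-- The truncated exponential is within `|t|` of one. -/
lemma abs_min_one_exp_sub_one_le (t : ℝ) : |min 1 (Real.exp t) - 1| ≤ |t| := by
  have h := Real.add_one_le_exp t
  rcases min_cases 1 (Real.exp t) with ⟨h1, -⟩ | ⟨h1, h2⟩
  · rw [h1]
    simp
  · rw [h1, abs_of_neg (by linarith)]
    linarith [neg_abs_le t]

/-- The acceptance factor differs from one by `O(ε)`, cubically in the jump. -/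
lemma abs_betaScaled_sub_one_le {d : ℕ} {D ρ : EuclideanSpace ℝ (Fin d) → ℝ} {c A B : ℝ}
    (hρ : ∀ x, 0 < ρ x) (hDdiff : Differentiable ℝ D)
    (hLdiff : Differentiable ℝ (fun y => Real.log (ρ y)))
    (hc : 0 < c) (hcD : ∀ x, c ≤ D x) (hA : ∀ x, ‖fderiv ℝ D x‖ ≤ A)
    (hB : ∀ x, ‖fderiv ℝ (fun y => Real.log (ρ y)) x‖ ≤ B)
    (x z : EuclideanSpace ℝ (Fin d)) {ε : ℝ} (hε : 0 ≤ ε) :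
    |betaScaled D ρ x z ε - 1|
      ≤ ε * (((d : ℝ) / 2 / c + 1 / (4 * c ^ 2)) * A + B) * (1 + ‖z‖) ^ 3 := by
  have hDpos : ∀ x, 0 < D x := fun x => hc.trans_le (hcD x)
  have hA0 : 0 ≤ A := (norm_nonneg _).trans (hA x)
  have hB0 : 0 ≤ B := (norm_nonneg _).trans (hB x)
  have hr := norm_nonneg z
  have h1 : (1 : ℝ) ≤ 1 + ‖z‖ := by linarith
  have hDz : |fderiv ℝ D x z| ≤ A * (1 + ‖z‖) := by
    have := (fderiv ℝ D x).le_of_opNorm_le (hA x) z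
    rw [Real.norm_eq_abs] at this
    nlinarith
  have hLz : |fderiv ℝ (fun y => Real.log (ρ y)) x z| ≤ B * (1 + ‖z‖) ^ 3 := by
    have := (fderiv ℝ (fun y => Real.log (ρ y)) x).le_of_opNorm_le (hB x) z
    rw [Real.norm_eq_abs] at this
    refine this.trans (mul_le_mul_of_nonneg_left ?_ hB0)
    exact (by linarith : ‖z‖ ≤ 1 + ‖z‖).trans (le_self_pow₀ h1 (by norm_num))
  have hcoef : |(-(d : ℝ) / 2 / D x + ‖z‖ ^ 2 / (4 * D x ^ 2))|
      ≤ ((d : ℝ) / 2 / c + 1 / (4 * c ^ 2)) * (1 + ‖z‖) ^ 2 := by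
    have hDx := hDpos x
    have e1 : |-(d : ℝ) / 2 / D x| ≤ (d : ℝ) / 2 / c * (1 + ‖z‖) ^ 2 := by
      rw [neg_div, neg_div, abs_neg, abs_of_nonneg (by positivity)]
      calc (d : ℝ) / 2 / D x ≤ (d : ℝ) / 2 / c := by gcongr; exact hcD x
        _ ≤ _ := le_mul_of_one_le_right (by positivity) (one_le_pow₀ h1)
    have e2 : |‖z‖ ^ 2 / (4 * D x ^ 2)| ≤ 1 / (4 * c ^ 2) * (1 + ‖z‖) ^ 2 := by
      rw [abs_of_nonneg (by positivity), one_div_mul_eq_div]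
      gcongr
      · linarith
      · exact hcD x
    rw [add_mul]
    exact (abs_add_le _ _).trans (add_le_add e1 e2)
  rw [betaScaled, inner_gradient_qscaled_div hDpos x z (hDdiff x),
    inner_gradient_div_eq_fderiv_log hρ x z (hLdiff x), ← mul_add]
  refine (abs_min_one_exp_sub_one_le _).trans ?_
  rw [abs_mul, abs_of_nonneg hε, mul_assoc]
  refine mul_le_mul_of_nonneg_left ((abs_add_le _ _).trans ?_) hε
  rw [abs_mul]
  calc _ ≤ (((d : ℝ) / 2 / c + 1 / (4 * c ^ 2)) * (1 + ‖z‖) ^ 2) * (A * (1 + ‖z‖))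
        + B * (1 + ‖z‖) ^ 3 :=
        add_le_add (mul_le_mul hcoef hDz (abs_nonneg _) (by positivity)) hLz
    _ = _ := by ring

/-- The trial density decays polynomially, with a constant polynomial in `D x`. -/
lemma one_add_norm_pow_mul_qscaled_le {d : ℕ} {D : EuclideanSpace ℝ (Fin d) → ℝ} {c : ℝ}
    (hc : 0 < c) (hcD : ∀ x, c ≤ D x) (k : ℕ) (x z : EuclideanSpace ℝ (Fin d)) :
    (1 + ‖z‖) ^ (2 * k) * qscaled D x z
      ≤ (4 * π * c) ^ (-(d : ℝ) / 2) * (2 ^ k * (k.factorial * Real.exp 1))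
        * (1 + 4 * D x) ^ k := by
  have hDx : 0 < D x := hc.trans_le (hcD x)
  have hrpow : (4 * π * D x) ^ (-(d : ℝ) / 2) ≤ (4 * π * c) ^ (-(d : ℝ) / 2) := by
    refine Real.rpow_le_rpow_of_nonpos (by positivity) ?_ ?_
    · gcongr
      exact hcD x
    · rw [neg_div]
      exact neg_nonpos.mpr (by positivity)
  have hexp := one_add_pow_mul_exp_neg_sq_div_le k (norm_nonneg z)
    (by positivity : 0 < 4 * D x)
  calc (1 + ‖z‖) ^ (2 * k) * qscaled D x z
      = (4 * π * D x) ^ (-(d : ℝ) / 2)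
        * ((1 + ‖z‖) ^ (2 * k) * Real.exp (-‖z‖ ^ 2 / (4 * D x))) := by
        rw [qscaled]
        ring
    _ ≤ (4 * π * c) ^ (-(d : ℝ) / 2)
        * (2 ^ k * (1 + 4 * D x) ^ k * (k.factorial * Real.exp 1)) := by gcongr
    _ = _ := by ring

/-- A function with bounded derivative has powers of polynomial growth. -/
lemma exists_one_add_four_mul_pow_le {E : Type*} [NormedAddCommGroup E] [NormedSpace ℝ E]
    {D : E → ℝ} {A : ℝ} (hDdiff : Differentiable ℝ D) (hD : ∀ x, 0 < D x)
    (hA : ∀ x, ‖fderiv ℝ D x‖ ≤ A) (k : ℕ) :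
    ∃ M : ℝ, 0 ≤ M ∧ ∀ x, (1 + 4 * D x) ^ k ≤ M * (1 + ‖x‖ ^ k) := by
  have hA0 : 0 ≤ A := (norm_nonneg _).trans (hA 0)
  have hD0 := hD 0
  refine ⟨(1 + 4 * D 0 + 4 * A) ^ k * 2 ^ (k - 1), by positivity, fun x => ?_⟩
  have hx := norm_nonneg x
  have hlip : D x ≤ D 0 + A * ‖x‖ := by
    have := convex_univ.norm_image_sub_le_of_norm_fderiv_le (𝕜 := ℝ)
      (fun y _ => hDdiff y) (fun y _ => hA y) (Set.mem_univ (0 : E)) (Set.mem_univ x)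
    rw [sub_zero, Real.norm_eq_abs] at this
    linarith [le_abs_self (D x - D 0)]
  have hDx := hD x
  calc (1 + 4 * D x) ^ k ≤ ((1 + 4 * D 0 + 4 * A) * (1 + ‖x‖)) ^ k := by
        gcongr
        nlinarith [mul_nonneg hD0.le hx]
    _ = (1 + 4 * D 0 + 4 * A) ^ k * (1 + ‖x‖) ^ k := mul_pow _ _ _
    _ ≤ (1 + 4 * D 0 + 4 * A) ^ k * (2 ^ (k - 1) * (1 ^ k + ‖x‖ ^ k)) := by
        gcongr
        exact add_pow_le zero_le_one hx k
    _ = _ := by rw [one_pow]; ring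

/-- for any polynomial `g`, the `q`-weighted integral of
`g(z)(β(x,z,ε) − 1)` is of order `ε`, with a constant of polynomial growth
in `x`. -/
theorem beta_polynomial_moment_estimate {d : ℕ} (hd : 1 ≤ d)
    (D ρeq : EuclideanSpace ℝ (Fin d) → ℝ)
    (hρeqpos : ∀ x, 0 < ρeq x)
    (hDsmooth : ContDiff ℝ 4 D)
    (hLsmooth : ContDiff ℝ 4 (fun x => Real.log (ρeq x)))
    (hDbd : ∀ i : ℕ, 1 ≤ i → i ≤ 4 → ∃ C : ℝ, ∀ x, ‖iteratedFDeriv ℝ i D x‖ ≤ C)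
    (hLbd : ∀ i : ℕ, 1 ≤ i → i ≤ 4 →
      ∃ C : ℝ, ∀ x, ‖iteratedFDeriv ℝ i (fun y => Real.log (ρeq y)) x‖ ≤ C)
    (hDinf : ∃ c : ℝ, 0 < c ∧ ∀ x, c ≤ D x)
    (g : MvPolynomial (Fin d) ℝ) :
    ∃ (Kstar : EuclideanSpace ℝ (Fin d) → ℝ) (C : ℝ) (m : ℕ),
      (∀ x, |Kstar x| ≤ C * (1 + ‖x‖ ^ m)) ∧
      ∀ x, ∀ ε ∈ Set.Ioc (0 : ℝ) 1,
        |∫ z, MvPolynomial.eval (fun i => z i) g * qscaled D x z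
            * (betaScaled D ρeq x z ε - 1)|
          ≤ Kstar x * ε := by
  obtain ⟨A, hA⟩ := hDbd 1 le_rfl (by norm_num)
  obtain ⟨B, hB⟩ := hLbd 1 le_rfl (by norm_num)
  obtain ⟨c, hc, hcD⟩ := hDinf
  obtain ⟨G, n, hG, hg⟩ := abs_mvPolynomial_eval_le g
  replace hA := norm_fderiv_le_of_norm_iteratedFDeriv_one_le hA
  replace hB := norm_fderiv_le_of_norm_iteratedFDeriv_one_le hB
  have hDdiff : Differentiable ℝ D := hDsmooth.differentiable (by norm_num)
  have hLdiff : Differentiable ℝ (fun x => Real.log (ρeq x)) :=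
    hLsmooth.differentiable (by norm_num)
  have hDpos : ∀ x, 0 < D x := fun x => hc.trans_le (hcD x)
  have hA0 : 0 ≤ A := (norm_nonneg _).trans (hA 0)
  have hB0 : 0 ≤ B := (norm_nonneg _).trans (hB 0)
  set k : ℕ := n + 3 + (d + 1) with hk
  obtain ⟨M, hM, hDM⟩ := exists_one_add_four_mul_pow_le hDdiff hDpos hA k
  set S : ℝ := ((d : ℝ) / 2 / c + 1 / (4 * c ^ 2)) * A + B
  set T : ℝ := (4 * π * c) ^ (-(d : ℝ) / 2) * (2 ^ k * (k.factorial * Real.exp 1))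
  set J : ℝ := ∫ z : EuclideanSpace ℝ (Fin d), (1 + ‖z‖) ^ (-((d : ℝ) + 1))
  have hJint : Integrable (fun z : EuclideanSpace ℝ (Fin d) =>
      (1 + ‖z‖) ^ (-((d : ℝ) + 1))) := integrable_one_add_norm (by simp)
  have hS0 : 0 ≤ S := by positivity
  have hT0 : 0 ≤ T := by positivity
  have hJ0 : 0 ≤ J := integral_nonneg fun z => by positivity
  refine ⟨fun x => G * S * T * M * J * (1 + ‖x‖ ^ k), G * S * T * M * J, k,
    fun x => (abs_of_nonneg (by positivity)).le, fun x ε hε => ?_⟩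
  have hε0 : 0 ≤ ε := hε.1.le
  rw [← Real.norm_eq_abs]
  have hbound : ∀ z : EuclideanSpace ℝ (Fin d),
      ‖MvPolynomial.eval (fun i => z i) g * qscaled D x z * (betaScaled D ρeq x z ε - 1)‖
        ≤ G * S * T * M * (1 + ‖x‖ ^ k) * ε * (1 + ‖z‖) ^ (-((d : ℝ) + 1)) := by
    intro z
    have hz : 0 < 1 + ‖z‖ := by positivity
    have hq0 : 0 ≤ qscaled D x z := by
      have := hDpos x
      rw [qscaled]
      positivity
    have hβ := abs_betaScaled_sub_one_le hρeqpos hDdiff hLdiff hc hcD hA hB x z hε0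
    have hq := one_add_norm_pow_mul_qscaled_le hc hcD k x z
    have hpow : (1 + ‖z‖) ^ (n + 3 + (d + 1)) ≤ (1 + ‖z‖) ^ (2 * k) :=
      pow_le_pow_right₀ (by linarith [norm_nonneg z]) (by omega)
    rw [norm_mul, norm_mul, Real.norm_eq_abs, Real.norm_eq_abs, Real.norm_eq_abs,
      abs_of_nonneg hq0, Real.rpow_neg hz.le, ← div_eq_mul_inv, le_div_iff₀ (by positivity),
      ← Nat.cast_succ, Real.rpow_natCast]
    calc _ ≤ G * (1 + ‖z‖) ^ n * qscaled D x z * (ε * S * (1 + ‖z‖) ^ 3)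
            * (1 + ‖z‖) ^ (d + 1) := by
          gcongr
          exact hg z
      _ = G * S * ε * ((1 + ‖z‖) ^ (n + 3 + (d + 1)) * qscaled D x z) := by ring
      _ ≤ G * S * ε * (T * (M * (1 + ‖x‖ ^ k))) := by
          refine mul_le_mul_of_nonneg_left ?_ (by positivity)
          calc _ ≤ (1 + ‖z‖) ^ (2 * k) * qscaled D x z := mul_le_mul_of_nonneg_right hpow hq0
            _ ≤ T * (1 + 4 * D x) ^ k := hq
            _ ≤ _ := mul_le_mul_of_nonneg_left (hDM x) hT0
      _ = _ := by ring
  refine (norm_integral_le_of_norm_le (hJint.const_mul _) (.of_forall hbound)).trans ?_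
  rw [integral_const_mul]
  exact le_of_eq (by ring)
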